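/- arXiv:2305.18278 — 2 statements merged into one kernel-verified Lean document; each statement's English description precedes it below -/
import Mathlib

section
/- For all integers n ≥ 3 and k ≥ 1, the central binomial coefficient binom(2k(n−1), k(n−1)) is strictly greater than binom(nk, k). Equivalently, since the Catalan number C_{k(n−1)} = binom(2k(n−1), k(n−1))/(k(n−1)+1) counts planar binary rooted trees with k(n−1)+1 leaves and the Fuss–Catalan number C^{(n)}_k = binom(nk, k)/((n−1)k+1) counts planar n-ary rooted trees with k(n−1)+1 leaves, and both have the same denominator (n−1)k+1, one has C_{k(n−1)} > C^{(n)}_k: there are strictly more planar binary rooted trees than planar n-ary rooted trees on the same number k(n−1)+1 of leaves. -/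
/-- For `n ≥ 3` and `k ≥ 1`, the central binomial coefficient
`binom(2k(n-1), k(n-1))` strictly exceeds `binom(nk, k)`:
there are strictly more planar binary rooted trees than planar `n`-ary
rooted trees on `k(n-1)+1` leaves. -/
theorem stmt_1 (n k : ℕ) (hn : 3 ≤ n) (hk : 1 ≤ k) :
    Nat.choose (2 * k * (n - 1)) (k * (n - 1)) > Nat.choose (n * k) k := by
  obtain ⟨m, rfl⟩ : ∃ m, n = m + 3 := ⟨n - 3, by omega⟩
  obtain ⟨N, hN⟩ : ∃ N, k * (m + 2) = N + 1 :=
    Nat.exists_eq_add_one.mpr (by positivity)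
  have hk_lt : k < N + 1 := by nlinarith
  have h_left : 2 * k * (m + 3 - 1) = 2 * (N + 1) := by
    rw [← hN, show m + 3 - 1 = m + 2 by omega, mul_assoc]
  have h_right : (m + 3) * k = k + (N + 1) := by rw [← hN]; ring
  rw [h_left, h_right, show m + 3 - 1 = m + 2 by omega, hN, Nat.choose_symm_add]
  calc (k + (N + 1)).choose (N + 1)
      < (k + (N + 1) + 1).choose (N + 1) := by
        rw [Nat.choose_succ_succ']
        have : 0 < (k + (N + 1)).choose N := Nat.choose_pos (by omega)
        omega
    _ ≤ (2 * (N + 1)).choose (N + 1) := Nat.choose_le_choose _ (by omega)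
end

section
/- Let F be a multiset of planar binary rooted trees (Mathlib's Multiset (Tree Unit), where Tree.nil is a leaf and Tree.node a binary branching), modeling a workspace; the number of syntactic objects is b₀(F) = Multiset.card F and the workspace size is σ(F) = the total number of vertices, i.e. the sum over T ∈ F of (T.numNodes + T.numLeaves). Suppose T₁ ∈ F and T₂ ∈ F.erase T₁, and let F' = (Tree.node () T₁ T₂) ::ₘ ((F.erase T₁).erase T₂) be the workspace obtained by External Merge of the two components T₁ and T₂. Then the number of accessible terms #Acc(F) = σ(F) − b₀(F) (the number of non-root vertices) increases by exactly two, #Acc(F') = #Acc(F) + 2, and the quantity σ̂(F) = b₀(F) + σ(F) is conserved: σ̂(F') = σ̂(F). -/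
/-- The number of syntactic objects in a workspace: the number of components. -/
def b₀ (F : Multiset (Tree Unit)) : ℕ := Multiset.card F

/-- The size of a workspace: the total number of vertices of the forest. -/
def σsize (F : Multiset (Tree Unit)) : ℕ :=
  (F.map (fun T => T.numNodes + T.numLeaves)).sum

/-- The number of accessible terms of a workspace: the non-root vertices. -/
def numAcc (F : Multiset (Tree Unit)) : ℕ := σsize F - b₀ F

/-- The second counting function `σ̂ = b₀ + σ`. -/
def σhat (F : Multiset (Tree Unit)) : ℕ := b₀ F + σsize F

theorem b₀_cons (T : Tree Unit) (F : Multiset (Tree Unit)) : b₀ (T ::ₘ F) = b₀ F + 1 :=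
  Multiset.card_cons T F

theorem σsize_cons (T : Tree Unit) (F : Multiset (Tree Unit)) :
    σsize (T ::ₘ F) = T.numNodes + T.numLeaves + σsize F := by
  simp [σsize]

theorem b₀_le_σsize (F : Multiset (Tree Unit)) : b₀ F ≤ σsize F := by
  induction F using Multiset.induction_on with
  | empty => simp [b₀]
  | cons T F ih =>
    have hT : 0 < T.numLeaves := BinaryTree.numLeaves_pos T
    rw [b₀_cons, σsize_cons]
    omega

/-- External Merge of two components `T₁, T₂` of a workspace `F` increases the
number of accessible terms by exactly two and conserves `σ̂ = b₀ + σ`. -/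
theorem stmt_5 (F : Multiset (Tree Unit)) (T₁ T₂ : Tree Unit)
    (h₁ : T₁ ∈ F) (h₂ : T₂ ∈ F.erase T₁)
    (F' : Multiset (Tree Unit))
    (hF' : F' = (Tree.node () T₁ T₂) ::ₘ ((F.erase T₁).erase T₂)) :
    numAcc F' = numAcc F + 2 ∧ σhat F' = σhat F := by
  obtain ⟨G, hG⟩ : ∃ G, G = (F.erase T₁).erase T₂ := ⟨_, rfl⟩
  have hF : F = T₁ ::ₘ T₂ ::ₘ G := by
    rw [hG, Multiset.cons_erase h₂, Multiset.cons_erase h₁]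
  rw [← hG] at hF'
  clear hG h₁ h₂
  subst hF hF'
  have hG := b₀_le_σsize G
  have h₁ : 0 < T₁.numLeaves := BinaryTree.numLeaves_pos T₁
  have h₂ : 0 < T₂.numLeaves := BinaryTree.numLeaves_pos T₂
  have hn : (Tree.node () T₁ T₂).numNodes = T₁.numNodes + T₂.numNodes + 1 := rfl
  have hl : (Tree.node () T₁ T₂).numLeaves = T₁.numLeaves + T₂.numLeaves := rfl
  simp only [numAcc, σhat, b₀_cons, σsize_cons, hn, hl]
  omega
end
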